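/- arXiv:2203.00912 — 4 statements merged into one kernel-verified Lean document; each statement's English description precedes it below -/
import Mathlib

section
/- Let X, Y, Z be topological spaces, let β : Y → Z and γ : X → Y be continuous maps, and let S ⊆ Z and T ⊆ Y be subsets with β(T) ⊆ S. Assume that the restriction of β to a map Y ∖ β⁻¹(S) → Z ∖ S is a covering map all of whose fibers are finite, and that the restriction of γ to a map X ∖ γ⁻¹(T) → Y ∖ T is a covering map. Then the restriction of β ∘ γ to a map X ∖ (β∘γ)⁻¹(S) → Z ∖ S is a covering map. -/
open Set Topology

/-- A local homeomorphism `h` evenly covers `z` if its restriction over a neighborhood `W` of `z`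
is parametrized by a discrete family of sections with pairwise disjoint images. -/
theorem IsLocalHomeomorph.isEvenlyCovered_of_sections {E Z D : Type*} [TopologicalSpace E]
    [TopologicalSpace Z] [TopologicalSpace D] [DiscreteTopology D] {h : E → Z}
    (hh : IsLocalHomeomorph h) {z : Z} {W : Set Z} (hW : IsOpen W) (hz : z ∈ W)
    (σ : W × D → E) (hσ : Continuous σ) (hinj : Function.Injective σ)
    (hsec : ∀ p, h (σ p) = p.1) (hrange : range σ = h ⁻¹' W) :
    IsEvenlyCovered h z D := by
  have hfst : IsLocalHomeomorph (Prod.fst : W × D → W) :=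
    IsCoveringMap.isLocalHomeomorph fun w => IsEvenlyCovered.to_isEvenlyCovered_preimage (I := D)
      ⟨‹_›, univ, mem_univ w, isOpen_univ, isOpen_univ, (Homeomorph.Set.univ (W × D)).trans
        ((Homeomorph.Set.univ W).symm.prodCongr (.refl D)), fun _ => rfl⟩
  have hcomp : IsLocalHomeomorph (h ∘ σ) := by
    rw [show h ∘ σ = Subtype.val ∘ Prod.fst from funext hsec]
    exact hW.isOpenEmbedding_subtypeVal.isLocalHomeomorph.comp hfst
  have hemb : IsOpenEmbedding σ := (hcomp.of_comp hh hσ).isOpenEmbedding_of_injective hinj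
  refine ⟨‹_›, W, hz, hW, hW.preimage hh.continuous,
    ((Homeomorph.setCongr hrange.symm).trans hemb.isEmbedding.toHomeomorph.symm), fun x => ?_⟩
  obtain ⟨p, rfl⟩ : ∃ p, (Homeomorph.setCongr hrange) (hemb.isEmbedding.toHomeomorph p) = x :=
    ((hemb.isEmbedding.toHomeomorph.trans (Homeomorph.setCongr hrange)).surjective x)
  rw [show (((Homeomorph.setCongr hrange.symm).trans hemb.isEmbedding.toHomeomorph.symm)
    ((Homeomorph.setCongr hrange) (hemb.isEmbedding.toHomeomorph p))) = p from
    hemb.isEmbedding.toHomeomorph.symm_apply_apply p]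
  exact (hsec p).symm

/-- The composition of a covering map with a covering map with finite fibers is a covering map. -/
theorem IsCoveringMap.comp_of_finite_fibers {E Y Z : Type*} [TopologicalSpace E]
    [TopologicalSpace Y] [TopologicalSpace Z] {g : Y → Z} {f : E → Y} (hg : IsCoveringMap g)
    (hfin : ∀ z, (g ⁻¹' {z}).Finite) (hf : IsCoveringMap f) : IsCoveringMap (g ∘ f) := by
  intro z
  obtain ⟨-, U, hzU, hU, -, H, hH⟩ := hg z
  have : Finite (g ⁻¹' {z}) := hfin z
  have := (hg z).1
  let s (i : g ⁻¹' {z}) (u : U) : Y := (H.symm (u, i)).1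
  have hs i : Continuous (s i) := by fun_prop
  have hgs i u : g (s i u) = u := by simp [s, ← hH]
  let y (i : g ⁻¹' {z}) : Y := s i ⟨z, hzU⟩
  choose hJ V hyV hV _ K hK using fun i => hf (y i)
  let W : Set Z := Subtype.val '' ⋂ i, s i ⁻¹' V i
  have hW : IsOpen W :=
    hU.isOpenMap_subtype_val _ (isOpen_iInter_of_finite fun i => (hV i).preimage (hs i))
  have hzW : z ∈ W := ⟨⟨z, hzU⟩, mem_iInter.2 hyV, rfl⟩
  have hWU : W ⊆ U := Subtype.coe_image_subset _ _
  have hWV (w : W) i : s i ⟨w, hWU w.2⟩ ∈ V i := by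
    obtain ⟨_, u, hu, rfl⟩ := w
    exact mem_iInter.1 hu i
  let σ (p : W × Σ i, f ⁻¹' {y i}) : E :=
    ((K p.2.1).symm (⟨s p.2.1 ⟨p.1, hWU p.1.2⟩, hWV p.1 p.2.1⟩, p.2.2)).1
  have hfσ p : f (σ p) = s p.2.1 ⟨p.1, hWU p.1.2⟩ := by simp [σ, ← hK]
  have hsec p : g (f (σ p)) = p.1 := by rw [hfσ, hgs]
  refine ((hg.isLocalHomeomorph.comp hf.isLocalHomeomorph).isEvenlyCovered_of_sections hW hzW σ
    ?_ ?_ hsec ?_).to_isEvenlyCovered_preimage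
  · refine continuous_prod_of_discrete_right.2 fun ⟨i, j⟩ => ?_
    exact continuous_subtype_val.comp ((K i).symm.continuous.comp
      ((((hs i).comp (by fun_prop)).subtype_mk fun w => hWV w i).prodMk continuous_const))
  · rintro ⟨w, i, j⟩ ⟨w', i', j'⟩ h
    have hsw := (hfσ _).symm.trans ((congrArg f h).trans (hfσ _))
    have hp := H.symm.injective (Subtype.ext hsw)
    obtain rfl : w = w' := Subtype.ext (congrArg (fun q => (q.1 : Z)) hp)
    obtain rfl : i = i' := congrArg Prod.snd hp
    obtain rfl : j = j' := congrArg Prod.snd ((K i).symm.injective (Subtype.ext h))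
    rfl
  · refine Subset.antisymm (range_subset_iff.2 fun p => ?_) fun x hx => ?_
    · rw [mem_preimage, Function.comp_apply, hsec]
      exact p.1.2
    · let i := (H ⟨f x, hWU hx⟩).2
      have hsx : s i ⟨g (f x), hWU hx⟩ = f x := by
        have : ((⟨g (f x), hWU hx⟩ : U), i) = H ⟨f x, hWU hx⟩ :=
          Prod.ext (Subtype.ext (hH ⟨f x, hWU hx⟩).symm) rfl
        simp only [s, this, H.symm_apply_apply]
      have hxV : f x ∈ V i := hsx ▸ hWV ⟨_, hx⟩ i
      refine ⟨(⟨_, hx⟩, ⟨i, (K i ⟨x, hxV⟩).2⟩), ?_⟩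
      have : ((⟨s i ⟨g (f x), hWU hx⟩, hWV ⟨_, hx⟩ i⟩ : V i), (K i ⟨x, hxV⟩).2) =
          K i ⟨x, hxV⟩ := Prod.ext (Subtype.ext (hsx.trans (hK i ⟨x, hxV⟩).symm)) rfl
      exact congrArg Subtype.val (((K i).symm_apply_eq).2 this)

/-- If `β : Y → Z` restricts to a covering map with finite fibers
away from `S` and `γ : X → Y` restricts to a covering map away from `T`, and
`β '' T ⊆ S`, then `β ∘ γ` restricts to a covering map away from `S`. -/
theorem stmt0 {X Y Z : Type*} [TopologicalSpace X] [TopologicalSpace Y] [TopologicalSpace Z]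
    (β : Y → Z) (γ : X → Y) (hβc : Continuous β) (hγc : Continuous γ)
    (S : Set Z) (T : Set Y) (hβT : β '' T ⊆ S)
    (hβ : IsCoveringMap
      (fun y : ((β ⁻¹' S)ᶜ : Set Y) => (⟨β y.1, fun hs => y.2 hs⟩ : (Sᶜ : Set Z))))
    (hβfin : ∀ z : (Sᶜ : Set Z),
      ((fun y : ((β ⁻¹' S)ᶜ : Set Y) =>
          (⟨β y.1, fun hs => y.2 hs⟩ : (Sᶜ : Set Z))) ⁻¹' {z}).Finite)
    (hγ : IsCoveringMap
      (fun x : ((γ ⁻¹' T)ᶜ : Set X) => (⟨γ x.1, fun ht => x.2 ht⟩ : (Tᶜ : Set Y)))) :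
    IsCoveringMap
      (fun x : (((β ∘ γ) ⁻¹' S)ᶜ : Set X) =>
        (⟨β (γ x.1), fun hs => x.2 hs⟩ : (Sᶜ : Set Z))) := by
  have hT {y : Y} (hy : β y ∉ S) : y ∉ T := fun ht => hy (hβT ⟨y, ht, rfl⟩)
  let t : Set (Tᶜ : Set Y) := {y | β y ∉ S}
  let eX : (((β ∘ γ) ⁻¹' S)ᶜ : Set X) ≃ₜ
      (fun x : ((γ ⁻¹' T)ᶜ : Set X) => (⟨γ x.1, fun ht => x.2 ht⟩ : (Tᶜ : Set Y))) ⁻¹' t :=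
    { toFun x := ⟨⟨x, hT x.2⟩, x.2⟩
      invFun x := ⟨x, x.2⟩ }
  let eY : t ≃ₜ ((β ⁻¹' S)ᶜ : Set Y) :=
    { toFun y := ⟨y, y.2⟩
      invFun y := ⟨⟨y, hT y.2⟩, y.2⟩ }
  exact hβ.comp_of_finite_fibers hβfin
    (((hγ.restrictPreimage t).comp_homeomorph eX).homeomorph_comp eY)
end

section
/- Let G and A be groups, E a type, ρ : G → Equiv.Perm E a group homomorphism, and f : G → (E → A) a function satisfying f(g₁·g₂)(e) = f(g₁)(e) · f(g₂)((ρ g₁)⁻¹ e) for all g₁, g₂ ∈ G and e ∈ E, and let φ : G → (E → A) ⋊ Equiv.Perm E be the group homomorphism φ(g) = (f(g), ρ(g)) with π₂ the projection onto Equiv.Perm E. Then: (i) the kernel of the restriction of π₂ to the image φ(G) equals φ(ker ρ); (ii) φ(ker ρ) is a normal subgroup of φ(G) and the quotient φ(G) ⧸ φ(ker ρ) is isomorphic to the image ρ(G); and (iii) ker φ is contained in ker ρ and φ(ker ρ) is isomorphic to the quotient ker ρ ⧸ ker φ. In other words, φ(G) is an extension 1 → ker ρ ⧸ ker φ → φ(G)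 → ρ(G) → 1. -/
/-- The wreath-product action: a permutation `σ` of `E` acts on `F : E → A` by
`(σ • F) e = F (σ⁻¹ e)`. -/
def permAction (A E : Type*) [Group A] : Equiv.Perm E →* MulAut (E → A) where
  toFun σ :=
    { toFun := fun F e => F (σ⁻¹ e)
      invFun := fun F e => F (σ e)
      left_inv := fun F => funext fun e => by simp
      right_inv := fun F => funext fun e => by simp
      map_mul' := fun F G => rfl }
  map_one' := MulEquiv.ext fun F => funext fun e => by simp
  map_mul' := fun σ τ => MulEquiv.ext fun F => funext fun e => by
    simp [MulAut.mul_apply, mul_inv_rev, Equiv.Perm.mul_apply]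

namespace MonoidHom

variable {G H K : Type*} [Group G] [Group H] [Group K]

theorem eq_one_iff_mem_map_ker_comp (π : H →* K) (φ : G →* H) {w : H} (hw : w ∈ φ.range) :
    π w = 1 ↔ w ∈ Subgroup.map φ (π.comp φ).ker := by
  obtain ⟨g, rfl⟩ := hw
  constructor
  · exact fun h => ⟨g, h, rfl⟩
  · rintro ⟨k, hk, hkg⟩
    rw [← hkg]
    exact hk

/-- The restriction of `π` to a homomorphism from the image of `φ` to the image of `π.comp φ`. -/
def rangeToCompRange (π : H →* K) (φ : G →* H) : φ.range →* (π.comp φ).range :=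
  (π.comp φ.range.subtype).codRestrict _ fun w => by
    obtain ⟨_, g, rfl⟩ := w
    exact ⟨g, rfl⟩

theorem rangeToCompRange_surjective (π : H →* K) (φ : G →* H) :
    Function.Surjective (rangeToCompRange π φ) := by
  rintro ⟨_, g, rfl⟩
  exact ⟨⟨φ g, g, rfl⟩, rfl⟩

theorem ker_rangeToCompRange (π : H →* K) (φ : G →* H) :
    (rangeToCompRange π φ).ker = (Subgroup.map φ (π.comp φ).ker).subgroupOf φ.range := by
  ext w
  rw [Subgroup.mem_subgroupOf, ← eq_one_iff_mem_map_ker_comp π φ w.2]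
  exact Subtype.ext_iff

theorem map_eq_range_comp_subtype (φ : G →* H) (N : Subgroup G) :
    Subgroup.map φ N = (φ.comp N.subtype).range := by
  rw [range_comp, Subgroup.range_subtype]

/-- The first isomorphism theorem for the image of a subgroup. -/
noncomputable def mapEquivQuotientKer (φ : G →* H) (N : Subgroup G) :
    Subgroup.map φ N ≃* N ⧸ (φ.comp N.subtype).ker :=
  (MulEquiv.subgroupCongr (map_eq_range_comp_subtype φ N)).trans
    (QuotientGroup.quotientKerEquivRange _).symm

end MonoidHom

/-- For `φ(g) = (f g, ρ g)` into the wreath product: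
(i) on the image `φ(G)`, the kernel of the second projection is exactly `φ(ker ρ)`;
(ii) `φ(ker ρ)` is normal in `φ(G)` with quotient isomorphic to `ρ(G)` (expressed by a
surjection `φ(G) → ρ(G)` with kernel `φ(ker ρ)`);
(iii) `ker φ ≤ ker ρ` and `φ(ker ρ) ≅ ker ρ ⧸ ker φ`.
Thus `φ(G)` is an extension `1 → ker ρ ⧸ ker φ → φ(G) → ρ(G) → 1`. -/
theorem stmt13 {G A : Type*} {E : Type*} [Group G] [Group A]
    (ρ : G →* Equiv.Perm E) (f : G → E → A)
    (hf : ∀ g₁ g₂ : G, ∀ e : E, f (g₁ * g₂) e = f g₁ e * f g₂ ((ρ g₁)⁻¹ e))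
    (φ : G →* (E → A) ⋊[permAction A E] Equiv.Perm E)
    (hφ : ∀ g, φ g = ⟨f g, ρ g⟩) :
    (∀ w ∈ φ.range, SemidirectProduct.rightHom w = 1 ↔ w ∈ Subgroup.map φ ρ.ker) ∧
    ((Subgroup.map φ ρ.ker).subgroupOf φ.range).Normal ∧
    (∃ ψ : ↥φ.range →* ↥ρ.range, Function.Surjective ψ ∧
      ψ.ker = (Subgroup.map φ ρ.ker).subgroupOf φ.range) ∧
    φ.ker ≤ ρ.ker ∧
    Nonempty (↥(Subgroup.map φ ρ.ker) ≃* (↥ρ.ker ⧸ (φ.comp ρ.ker.subtype).ker)) := by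
  obtain rfl : SemidirectProduct.rightHom.comp φ = ρ := MonoidHom.ext fun g => by simp [hφ]
  refine ⟨fun w hw => MonoidHom.eq_one_iff_mem_map_ker_comp _ φ hw, ?_,
    ⟨MonoidHom.rangeToCompRange _ φ, MonoidHom.rangeToCompRange_surjective _ φ,
      MonoidHom.ker_rangeToCompRange _ φ⟩, ?_, ⟨MonoidHom.mapEquivQuotientKer φ _⟩⟩
  · rw [← MonoidHom.ker_rangeToCompRange]
    infer_instance
  · intro g hg
    rw [MonoidHom.mem_ker] at hg ⊢
    rw [MonoidHom.comp_apply, hg, map_one]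
end

section
/- In the permutation group of ZMod 2 × ZMod 3, consider the permutations u : (s, t) ↦ (if t = 1 then s + 1 else s, t + 1), v₁ : (s, t) ↦ (s, t + 1), and v₂ : (s, t) ↦ (if t = 0 then s + 1 else s, t). Then the subgroup generated by u is cyclic of order 6 (equivalently, u has order 6), while the subgroup generated by {v₁, v₂} is isomorphic to the direct product of a cyclic group of order 2 and the alternating group A₄ (in particular it has order 24). Consequently, the two subgroups are not isomorphic. -/
/-- The permutation `u : (s, t) ↦ (if t = 1 then s + 1 else s, t + 1)` of
`ZMod 2 × ZMod 3`. -/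
noncomputable def uPerm : Equiv.Perm (ZMod 2 × ZMod 3) :=
  Equiv.ofBijective (fun st => (if st.2 = 1 then st.1 + 1 else st.1, st.2 + 1)) (by decide)

/-- The permutation `v₁ : (s, t) ↦ (s, t + 1)` of `ZMod 2 × ZMod 3`. -/
noncomputable def v₁Perm : Equiv.Perm (ZMod 2 × ZMod 3) :=
  Equiv.ofBijective (fun st => (st.1, st.2 + 1)) (by decide)

/-- The permutation `v₂ : (s, t) ↦ (if t = 0 then s + 1 else s, t)` of
`ZMod 2 × ZMod 3`. -/
noncomputable def v₂Perm : Equiv.Perm (ZMod 2 × ZMod 3) :=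
  Equiv.ofBijective (fun st => (if st.2 = 0 then st.1 + 1 else st.1, st.2)) (by decide)

/-- The `2`-subsets of `Fin 4` labelled by `ZMod 2 × ZMod 3`: `{0, t + 1}` has label `(0, t)`, and
complementation changes the first coordinate. -/
def pairLabel (a b : Fin 4) : ZMod 2 × ZMod 3 :=
  if a = 0 then (0, (b.val : ZMod 3) - 1)
  else if b = 0 then (0, (a.val : ZMod 3) - 1)
  else (1, -(a.val : ZMod 3) - b.val - 1)

/-- A permutation of `Fin 4` acts on the labels of `2`-subsets, and the factor `ZMod 2` acts by
complementation. -/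
def pairAct (p : Multiplicative (ZMod 2) × Equiv.Perm (Fin 4)) (x : ZMod 2 × ZMod 3) :
    ZMod 2 × ZMod 3 :=
  pairLabel (p.2 0) (p.2 (Fin.ofNat 4 (x.2.val + 1))) + (x.1 + p.1.toAdd, 0)

theorem pairAct_pairLabel (σ : Equiv.Perm (Fin 4)) (a b : Fin 4) (h : a ≠ b) (c r : ZMod 2) :
    pairAct (Multiplicative.ofAdd c, σ) (pairLabel a b + (r, 0)) =
      pairLabel (σ a) (σ b) + (r + c, 0) := by
  revert σ a b c r
  decide +kernel

theorem pairAct_one (x : ZMod 2 × ZMod 3) : pairAct 1 x = x := by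
  revert x
  decide +kernel

theorem pairAct_mul (p q : Multiplicative (ZMod 2) × Equiv.Perm (Fin 4)) (x : ZMod 2 × ZMod 3) :
    pairAct (p * q) x = pairAct p (pairAct q x) := by
  have hx : (0 : Fin 4) ≠ Fin.ofNat 4 (x.2.val + 1) := by
    revert x
    decide
  have h := pairAct_pairLabel p.2 _ _ (q.2.injective.ne hx) p.1.toAdd (x.1 + q.1.toAdd)
  refine Eq.trans ?_ h.symm
  simp only [pairAct, Prod.fst_mul, Prod.snd_mul, Equiv.Perm.mul_apply, toAdd_mul]
  congr 2
  ring

/-- The action of `C₂ × S₄` on the labels of `2`-subsets of `Fin 4`. -/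
def pairHom : Multiplicative (ZMod 2) × Equiv.Perm (Fin 4) →* Equiv.Perm (ZMod 2 × ZMod 3) where
  toFun p := ⟨pairAct p, pairAct p⁻¹,
    fun x => by rw [← pairAct_mul, inv_mul_cancel, pairAct_one],
    fun x => by rw [← pairAct_mul, mul_inv_cancel, pairAct_one]⟩
  map_one' := Equiv.ext pairAct_one
  map_mul' p q := Equiv.ext (pairAct_mul p q)

theorem pairHom_injective : Function.Injective pairHom := by
  rw [injective_iff_map_eq_one]
  have h : ∀ p, (∀ x, pairAct p x = x) → p = 1 := by decide +kernel
  exact fun p hp => h p fun x => DFunLike.congr_fun hp x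

/-- The action of `C₂ × A₄` on the labels of `2`-subsets of `Fin 4`. -/
def pairHomAlternating :
    Multiplicative (ZMod 2) × alternatingGroup (Fin 4) →* Equiv.Perm (ZMod 2 × ZMod 3) :=
  pairHom.comp ((MonoidHom.id _).prodMap (alternatingGroup (Fin 4)).subtype)

theorem pairHomAlternating_injective : Function.Injective pairHomAlternating :=
  pairHom_injective.comp (Function.injective_id.prodMap Subtype.val_injective)

theorem v₁Perm_mem_range : v₁Perm ∈ pairHomAlternating.range := by
  have h : ∃ p : Multiplicative (ZMod 2) × alternatingGroup (Fin 4),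
      ∀ x : ZMod 2 × ZMod 3, pairAct (p.1, p.2.1) x = (x.1, x.2 + 1) := by decide +kernel
  exact h.imp fun p hp => Equiv.ext hp

theorem v₂Perm_mem_range : v₂Perm ∈ pairHomAlternating.range := by
  have h : ∃ p : Multiplicative (ZMod 2) × alternatingGroup (Fin 4),
      ∀ x : ZMod 2 × ZMod 3,
        pairAct (p.1, p.2.1) x = (if x.2 = 0 then x.1 + 1 else x.1, x.2) := by
    decide +kernel
  exact h.imp fun p hp => Equiv.ext hp

/-- Every element of the image of `C₂ × A₄` is a cyclic shift followed by sign changes. -/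
theorem exists_pairHomAlternating_eq (p : Multiplicative (ZMod 2) × alternatingGroup (Fin 4)) :
    ∃ a b c : Fin 2, ∃ d : Fin 3, pairHomAlternating p =
      (v₂Perm ^ a.val * v₁Perm) * (v₂Perm ^ b.val * v₁Perm) * (v₂Perm ^ c.val * v₁Perm) *
        v₁Perm ^ d.val := by
  have h : ∀ p : Multiplicative (ZMod 2) × alternatingGroup (Fin 4),
      ∃ a b c : Fin 2, ∃ d : Fin 3, ∀ x : ZMod 2 × ZMod 3,
        pairAct (p.1, p.2.1) x =
          let v₁ : ZMod 2 × ZMod 3 → ZMod 2 × ZMod 3 := fun x => (x.1, x.2 + 1)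
          let v₂ : ZMod 2 × ZMod 3 → ZMod 2 × ZMod 3 :=
            fun x => (if x.2 = 0 then x.1 + 1 else x.1, x.2)
          v₂^[a.val] (v₁ (v₂^[b.val] (v₁ (v₂^[c.val] (v₁ (v₁^[d.val] x)))))) := by
    decide +kernel
  obtain ⟨a, b, c, d, h⟩ := h p
  refine ⟨a, b, c, d, Equiv.ext fun x => (h x).trans ?_⟩
  simp only [Equiv.Perm.mul_apply, ← Equiv.Perm.iterate_eq_pow]
  rfl

theorem range_pairHomAlternating :
    pairHomAlternating.range = Subgroup.closure {v₁Perm, v₂Perm} := by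
  apply le_antisymm
  · rintro _ ⟨p, rfl⟩
    obtain ⟨a, b, c, d, h⟩ := exists_pairHomAlternating_eq p
    have h₁ : v₁Perm ∈ Subgroup.closure {v₁Perm, v₂Perm} := Subgroup.subset_closure (by simp)
    have h₂ : v₂Perm ∈ Subgroup.closure {v₁Perm, v₂Perm} := Subgroup.subset_closure (by simp)
    have hm (n : ℕ) := mul_mem (pow_mem h₂ n) h₁
    rw [h]
    exact mul_mem (mul_mem (mul_mem (hm _) (hm _)) (hm _)) (pow_mem h₁ _)
  · rw [Subgroup.closure_le]
    rintro _ (rfl | rfl)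
    exacts [v₁Perm_mem_range, v₂Perm_mem_range]

theorem orderOf_uPerm : orderOf uPerm = 6 := by
  have h : ∀ x : ZMod 2 × ZMod 3,
      (fun x : ZMod 2 × ZMod 3 => (if x.2 = 1 then x.1 + 1 else x.1, x.2 + 1))^[6] x = x := by
    decide +kernel
  have h' : ∀ m < 6, 0 < m → ∃ x : ZMod 2 × ZMod 3,
      (fun x : ZMod 2 × ZMod 3 => (if x.2 = 1 then x.1 + 1 else x.1, x.2 + 1))^[m] x ≠ x := by
    decide +kernel
  rw [orderOf_eq_iff (by norm_num)]
  refine ⟨Equiv.ext fun x => ?_, fun m hm hm₀ hu => ?_⟩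
  · rw [← Equiv.Perm.iterate_eq_pow]
    exact h x
  · obtain ⟨x, hx⟩ := h' m hm hm₀
    apply hx
    have := DFunLike.congr_fun hu x
    rwa [← Equiv.Perm.iterate_eq_pow] at this

/-- The subgroup generated by `u` is cyclic of order `6`
(equivalently `u` has order `6`), while the subgroup generated by `{v₁, v₂}` is
isomorphic to `C₂ × A₄` (in particular it has order `24`); consequently the two
subgroups are not isomorphic. -/
theorem stmt14 :
    orderOf uPerm = 6 ∧
    IsCyclic ↥(Subgroup.closure {uPerm}) ∧
    Nat.card ↥(Subgroup.closure {uPerm}) = 6 ∧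
    Nonempty (↥(Subgroup.closure {v₁Perm, v₂Perm}) ≃*
      Multiplicative (ZMod 2) × alternatingGroup (Fin 4)) ∧
    Nat.card ↥(Subgroup.closure {v₁Perm, v₂Perm}) = 24 ∧
    IsEmpty (↥(Subgroup.closure {uPerm}) ≃* ↥(Subgroup.closure {v₁Perm, v₂Perm})) := by
  have hu : Nat.card (Subgroup.closure {uPerm}) = 6 := by
    rw [← Subgroup.zpowers_eq_closure, Nat.card_zpowers, orderOf_uPerm]
  let e : Subgroup.closure {v₁Perm, v₂Perm} ≃*
      Multiplicative (ZMod 2) × alternatingGroup (Fin 4) :=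
    ((MonoidHom.ofInjective pairHomAlternating_injective).trans
      (MulEquiv.subgroupCongr range_pairHomAlternating)).symm
  have hv : Nat.card (Subgroup.closure {v₁Perm, v₂Perm}) = 24 := by
    rw [Nat.card_congr e.toEquiv, Nat.card_prod, nat_card_alternatingGroup]
    simp [Nat.factorial]
  refine ⟨orderOf_uPerm, ?_, hu, ⟨e⟩, hv, ⟨fun f => ?_⟩⟩
  · rw [← Subgroup.zpowers_eq_closure]
    infer_instance
  · have := Nat.card_congr f.toEquiv
    omega
end

section
/- In the permutation group of ZMod 3 × ZMod 3, consider the permutations g₁ : (s, t) ↦ (if t = 2 then (Equiv.swap 0 2) s else s, t + 1) and g₂ : (s, t) ↦ (if t = 0 then (Equiv.swap 0 1) s else s, t). Then the subgroup generated by {g₁, g₂} has cardinality 648; it is the semidirect product (S₃ × S₃ × S₃) ⋊ C₃, where C₃ cyclically permutes the three S₃ factors. -/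
/-- The permutation `g₁ : (s, t) ↦ (if t = 2 then (swap 0 2) s else s, t + 1)` of
`ZMod 3 × ZMod 3`. -/
noncomputable def g₁Perm : Equiv.Perm (ZMod 3 × ZMod 3) :=
  Equiv.ofBijective
    (fun st => (if st.2 = 2 then Equiv.swap (0 : ZMod 3) 2 st.1 else st.1, st.2 + 1))
    (by decide)

/-- The permutation `g₂ : (s, t) ↦ (if t = 0 then (swap 0 1) s else s, t)` of
`ZMod 3 × ZMod 3`. -/
noncomputable def g₂Perm : Equiv.Perm (ZMod 3 × ZMod 3) :=
  Equiv.ofBijective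
    (fun st => (if st.2 = 0 then Equiv.swap (0 : ZMod 3) 1 st.1 else st.1, st.2))
    (by decide)

/-- The action of `C₃ = Multiplicative (ZMod 3)` on `S₃ × S₃ × S₃`
(three copies of `Perm (ZMod 3)` indexed by `ZMod 3`) cyclically permuting the
three factors. -/
def shiftAction : Multiplicative (ZMod 3) →* MulAut (ZMod 3 → Equiv.Perm (ZMod 3)) where
  toFun c :=
    { toFun := fun F i => F (i - c.toAdd)
      invFun := fun F i => F (i + c.toAdd)
      left_inv := fun F => funext fun i => by simp
      right_inv := fun F => funext fun i => by simp
      map_mul' := fun F G => rfl }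
  map_one' := MulEquiv.ext fun F => funext fun i => by simp
  map_mul' := fun c d => MulEquiv.ext fun F => funext fun i => by
    simp [MulAut.mul_apply, sub_sub]

open Equiv

/-- The imprimitive action of the wreath product on `ZMod 3 × ZMod 3`. -/
def wreathPermHom :
    (ZMod 3 → Perm (ZMod 3)) ⋊[shiftAction] Multiplicative (ZMod 3) →*
      Perm (ZMod 3 × ZMod 3) where
  toFun x :=
    { toFun := fun st => (x.left (st.2 + x.right.toAdd) st.1, st.2 + x.right.toAdd)
      invFun := fun st => ((x.left st.2)⁻¹ st.1, st.2 - x.right.toAdd)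
      left_inv := fun st => by simp
      right_inv := fun st => by simp }
  map_one' := by ext st <;> simp
  map_mul' x y := by
    have hadd (t : ZMod 3) : t + (x * y).right.toAdd = t + y.right.toAdd + x.right.toAdd := by
      rw [SemidirectProduct.mul_right, toAdd_mul, add_assoc, add_comm x.right.toAdd]
    refine Equiv.ext fun st => Prod.ext ?_ (hadd st.2)
    change (x * y).left (st.2 + (x * y).right.toAdd) st.1 =
      x.left (st.2 + y.right.toAdd + x.right.toAdd) (y.left (st.2 + y.right.toAdd) st.1)
    have hleft (t : ZMod 3) : (x * y).left t = x.left t * y.left (t - x.right.toAdd) := rfl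
    rw [hadd, hleft, add_sub_cancel_right, Perm.mul_apply]

theorem wreathPermHom_apply
    (x : (ZMod 3 → Perm (ZMod 3)) ⋊[shiftAction] Multiplicative (ZMod 3))
    (st : ZMod 3 × ZMod 3) :
    wreathPermHom x st = (x.left (st.2 + x.right.toAdd) st.1, st.2 + x.right.toAdd) :=
  rfl

theorem wreathPermHom_injective : Function.Injective wreathPermHom := by
  intro x y h
  have happ (s t : ZMod 3) := Equiv.congr_fun h (s, t)
  simp only [wreathPermHom_apply, Prod.mk.injEq] at happ
  have hr : x.right = y.right := Multiplicative.toAdd.injective (add_left_cancel (happ 0 0).2)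
  refine SemidirectProduct.ext (funext fun i => Equiv.ext fun s => ?_) hr
  simpa [hr] using (happ s (i - y.right.toAdd)).1

/-- The preimage of `g₁Perm` in the wreath product. -/
def wreathGen₁ : (ZMod 3 → Perm (ZMod 3)) ⋊[shiftAction] Multiplicative (ZMod 3) :=
  ⟨Pi.mulSingle 0 (swap 0 2), Multiplicative.ofAdd 1⟩

/-- The preimage of `g₂Perm` in the wreath product. -/
def wreathGen₂ : (ZMod 3 → Perm (ZMod 3)) ⋊[shiftAction] Multiplicative (ZMod 3) :=
  SemidirectProduct.inl (Pi.mulSingle 0 (swap 0 1))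

theorem wreathPermHom_wreathGen₁ : wreathPermHom wreathGen₁ = g₁Perm :=
  Equiv.ext (by decide)

theorem wreathPermHom_wreathGen₂ : wreathPermHom wreathGen₂ = g₂Perm :=
  Equiv.ext (by decide)

theorem shiftAction_mulSingle (i c : ZMod 3) (p : Perm (ZMod 3)) :
    shiftAction (Multiplicative.ofAdd c) (Pi.mulSingle i p) = Pi.mulSingle (i + c) p := by
  funext j
  simp [shiftAction, Pi.mulSingle_apply, sub_eq_iff_eq_add]

theorem wreathGen₁_conj (i : ZMod 3) (p : Perm (ZMod 3)) :
    wreathGen₁ * SemidirectProduct.inl (Pi.mulSingle i p) * wreathGen₁⁻¹ =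
      SemidirectProduct.inl (Pi.mulSingle (i + 1)
        ((Pi.mulSingle 0 (swap 0 2) : ZMod 3 → Perm (ZMod 3)) (i + 1) * p *
          ((Pi.mulSingle 0 (swap 0 2) : ZMod 3 → Perm (ZMod 3)) (i + 1))⁻¹)) := by
  rw [mul_inv_eq_iff_eq_mul]
  refine SemidirectProduct.ext ?_ (by simp [wreathGen₁])
  funext j
  simp only [wreathGen₁, SemidirectProduct.mul_left, SemidirectProduct.left_inl,
    SemidirectProduct.right_inl, shiftAction_mulSingle, map_one, MulAut.one_apply, Pi.mul_apply]
  by_cases hj : j = i + 1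
  · subst hj
    simp
  · simp [Pi.mulSingle_eq_of_ne hj]

theorem closure_swap_swap_zmod_three :
    Subgroup.closure {swap (0 : ZMod 3) 1, swap (1 : ZMod 3) 2} = ⊤ := by
  set K := Subgroup.closure {swap (0 : ZMod 3) 1, swap (1 : ZMod 3) 2}
  have hx : swap (0 : ZMod 3) 1 ∈ K := Subgroup.subset_closure (by simp)
  have hy : swap (1 : ZMod 3) 2 ∈ K := Subgroup.subset_closure (by simp)
  have key : ∀ p : Perm (ZMod 3), p = 1 ∨ p = swap 0 1 ∨ p = swap 1 2 ∨
      p = swap 0 1 * swap 1 2 ∨ p = swap 1 2 * swap 0 1 ∨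
      p = swap 0 1 * swap 1 2 * swap 0 1 := by decide
  refine (Subgroup.eq_top_iff' K).2 fun p => ?_
  rcases key p with rfl | rfl | rfl | rfl | rfl | rfl
  · exact K.one_mem
  · exact hx
  · exact hy
  · exact K.mul_mem hx hy
  · exact K.mul_mem hy hx
  · exact K.mul_mem (K.mul_mem hx hy) hx

theorem closure_wreathGen : Subgroup.closure {wreathGen₁, wreathGen₂} = ⊤ := by
  set K := Subgroup.closure {wreathGen₁, wreathGen₂}
  have h₁ : wreathGen₁ ∈ K := Subgroup.subset_closure (by simp)
  have h₂ : wreathGen₂ ∈ K := Subgroup.subset_closure (by simp)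
  have conj_mem (i : ZMod 3) (p : Perm (ZMod 3))
      (h : SemidirectProduct.inl (Pi.mulSingle i p) ∈ K) :=
    wreathGen₁_conj i p ▸ K.mul_mem (K.mul_mem h₁ h) (K.inv_mem h₁)
  have h_swap : SemidirectProduct.inl (Pi.mulSingle (0 : ZMod 3) (swap (1 : ZMod 3) 2)) ∈ K := by
    convert conj_mem _ _ (conj_mem _ _ (conj_mem 0 (swap 0 1) h₂)) using 2
    decide
  have h_zero (p : Perm (ZMod 3)) : SemidirectProduct.inl (Pi.mulSingle 0 p) ∈ K := by
    let f := (SemidirectProduct.inl (φ := shiftAction)).comp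
      (MonoidHom.mulSingle (fun _ : ZMod 3 => Perm (ZMod 3)) 0)
    have hle : Subgroup.closure {swap (0 : ZMod 3) 1, swap (1 : ZMod 3) 2} ≤ K.comap f := by
      rw [Subgroup.closure_le, Set.pair_subset_iff]
      exact ⟨h₂, h_swap⟩
    rw [closure_swap_swap_zmod_three] at hle
    exact hle (Subgroup.mem_top p)
  have h_succ (i : ZMod 3)
      (h : ∀ p : Perm (ZMod 3), SemidirectProduct.inl (Pi.mulSingle i p) ∈ K)
      (p : Perm (ZMod 3)) : SemidirectProduct.inl (Pi.mulSingle (i + 1) p) ∈ K := by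
    let q := (Pi.mulSingle 0 (swap 0 2) : ZMod 3 → Perm (ZMod 3)) (i + 1)
    have hq : q * (q⁻¹ * p * q) * q⁻¹ = p := by group
    have := conj_mem i _ (h (q⁻¹ * p * q))
    rwa [hq] at this
  have h_single (i : ZMod 3) (p : Perm (ZMod 3)) :
      SemidirectProduct.inl (Pi.mulSingle i p) ∈ K := by
    fin_cases i
    · exact h_zero p
    · exact h_succ 0 h_zero p
    · exact h_succ 1 (h_succ 0 h_zero) p
  have h_inl (F : ZMod 3 → Perm (ZMod 3)) : SemidirectProduct.inl F ∈ K :=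
    Subgroup.pi_mem_of_mulSingle_mem (H := K.comap SemidirectProduct.inl) F
      fun i => h_single i (F i)
  have h_one : SemidirectProduct.inr (Multiplicative.ofAdd 1) ∈ K := by
    have := K.mul_mem (K.inv_mem (h_inl wreathGen₁.left)) h₁
    nth_rw 2 [← SemidirectProduct.inl_left_mul_inr_right wreathGen₁] at this
    rwa [inv_mul_cancel_left] at this
  refine (Subgroup.eq_top_iff' K).2 fun x => ?_
  have hx : x.right = Multiplicative.ofAdd (1 : ZMod 3) ^ x.right.toAdd.val := by
    rw [← ofAdd_nsmul]
    simp
  rw [← SemidirectProduct.inl_left_mul_inr_right x, hx, map_pow]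
  exact K.mul_mem (h_inl _) (K.pow_mem h_one _)

theorem range_wreathPermHom :
    wreathPermHom.range = Subgroup.closure {g₁Perm, g₂Perm} := by
  rw [MonoidHom.range_eq_map, ← closure_wreathGen, MonoidHom.map_closure, Set.image_pair,
    wreathPermHom_wreathGen₁, wreathPermHom_wreathGen₂]

/-- The subgroup of `Perm (ZMod 3 × ZMod 3)` generated by
`g₁` and `g₂` has cardinality `648`; it is the semidirect product
`(S₃ × S₃ × S₃) ⋊ C₃` in which `C₃` cyclically permutes the three `S₃` factors. -/
theorem stmt15 :
    Nat.card ↥(Subgroup.closure {g₁Perm, g₂Perm}) = 648 ∧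
    Nonempty (↥(Subgroup.closure {g₁Perm, g₂Perm}) ≃*
      (ZMod 3 → Equiv.Perm (ZMod 3)) ⋊[shiftAction] Multiplicative (ZMod 3)) := by
  let e := (MulEquiv.subgroupCongr range_wreathPermHom).symm.trans
    (MonoidHom.ofInjective wreathPermHom_injective).symm
  refine ⟨?_, ⟨e⟩⟩
  rw [Nat.card_congr e.toEquiv, SemidirectProduct.card, Nat.card_fun]
  simp [Fintype.card_perm, Nat.factorial]
end
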